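/- Let G be a finite group with commutator subgroup G', let k ≥ 1 and ℓ ≥ 1 be integers, and let 𝒞 be a subset of G closed under conjugation. For each coset αG' of G' in G let δ_α = |𝒞 ∩ αG'| / |G'|, and let δ = min over all cosets αG' of δ_α; assume δ > 0. Let w denote the result of a simple random walk of length 2ℓ in F_k. Let B ≥ 0 be a real number, and suppose that for every nonlinear irreducible character χ of G, the expectation, jointly over w and over independent uniform x_1, …, x_k ∈ G, of Re(χ(w(x_1, …, x_k))) / χ(1) is at most B. Choose x_0, x_1, …, x_k independently and uniformly at random from G, and let E be the event that x_0 · u(x_1, …, x_k) ∉ 𝒞 for every word u ∈ F_k of reduced length at most ℓ. Then the probability of E is at most δ^{−1} · B. -/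

import Mathlib

open CategoryTheory

/-- The word `s_ℓ ⋯ s_1 ∈ F_k` determined by a sequence of `ℓ` steps, with each
step `s_t = (i, b)` standing for `ξ_i` if `b = true` and `ξ_i⁻¹` if `b = false`.
A uniformly random `s : Fin ℓ → Fin k × Bool` thus gives the result of a simple
random walk of length `ℓ` in `F_k`. -/
def walkWord {k ℓ : ℕ} (s : Fin ℓ → Fin k × Bool) : FreeGroup (Fin k) :=
  (List.ofFn fun t : Fin ℓ =>
    if (s t).2 then FreeGroup.of (s t).1 else (FreeGroup.of (s t).1)⁻¹).reverse.prod

/-- The minimal fibre density `δ = min_α |𝒞 ∩ αG'|/|G'|` of a subset `𝒞` of a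
finite group `G` over the abelianization: for each `α ∈ G` the fibre is
`𝒞 ∩ αG'` where `G'` is the commutator subgroup. -/
noncomputable def minFibreDensity {G : Type} [Group G] (𝒞 : Set G) : ℝ :=
  ⨅ α : G,
    (Nat.card {g : G // g ∈ 𝒞 ∧ α⁻¹ * g ∈ commutator G} : ℝ) /
      (Nat.card ↥(commutator G) : ℝ)

section Walk

/-- The generator or inverse generator of the free group encoded by a step. -/
def stepWord {k : ℕ} (p : Fin k × Bool) : FreeGroup (Fin k) :=
  if p.2 then FreeGroup.of p.1 else (FreeGroup.of p.1)⁻¹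

theorem walkWord_succ {k n : ℕ} (s : Fin (n + 1) → Fin k × Bool) :
    walkWord s = walkWord (Fin.tail s) * stepWord (s 0) := by
  simp only [walkWord, stepWord, List.ofFn_succ, Fin.tail, List.reverse_cons, List.prod_append,
    List.prod_singleton]
  rfl

theorem norm_stepWord_le {k : ℕ} (p : Fin k × Bool) : (stepWord p).norm ≤ 1 := by
  unfold stepWord
  split <;> simp [FreeGroup.norm_inv_eq]

theorem norm_walkWord_le {k n : ℕ} (s : Fin n → Fin k × Bool) : (walkWord s).norm ≤ n := by
  induction n with
  | zero => simp [walkWord]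
  | succ n ih =>
    rw [walkWord_succ]
    exact (FreeGroup.norm_mul_le _ _).trans <| add_le_add (ih _) (norm_stepWord_le _)

variable {G V : Type*} [Group G] [AddCommGroup V] [Module ℂ V] {k : ℕ}

/-- The unnormalised one-step operator of the walk driven by `x`. -/
noncomputable def stepOperator (ρ : Representation ℂ G V) (x : Fin k → G) : Module.End ℂ V :=
  ∑ p : Fin k × Bool, ρ (FreeGroup.lift x (stepWord p))

theorem sum_walkWord_eq_stepOperator_pow (ρ : Representation ℂ G V) (x : Fin k → G) (n : ℕ) :
    ∑ s : Fin n → Fin k × Bool, ρ (FreeGroup.lift x (walkWord s)) = stepOperator ρ x ^ n := by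
  induction n with
  | zero => simp [walkWord]
  | succ n ih =>
    rw [pow_succ, ← ih, stepOperator, Finset.sum_mul_sum, Finset.sum_comm,
      ← Fintype.sum_prod_type' (f := fun p s => ρ (FreeGroup.lift x (walkWord s)) *
        ρ (FreeGroup.lift x (stepWord p)))]
    refine (Fintype.sum_equiv (Fin.consEquiv fun _ => Fin k × Bool) _ _ fun q => ?_).symm
    simp [walkWord_succ, Fin.consEquiv]

theorem freeGroupLift_conj (x : Fin k → G) (g : G) (u : FreeGroup (Fin k)) :
    FreeGroup.lift (fun i => g * x i * g⁻¹) u = g * FreeGroup.lift x u * g⁻¹ := by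
  have : FreeGroup.lift (fun i => g * x i * g⁻¹) =
      (MulAut.conj g).toMonoidHom.comp (FreeGroup.lift x) := by
    ext i; simp
  rw [this]; simp

/-- The unnormalised walk operator, summed over all evaluations of the generators. -/
noncomputable def walkOperator [Fintype G] (ρ : Representation ℂ G V) (k n : ℕ) :
    Module.End ℂ V :=
  ∑ x : Fin k → G, stepOperator ρ x ^ n

theorem walkOperator_eq_sum [Fintype G] (ρ : Representation ℂ G V) (k n : ℕ) :
    walkOperator ρ k n = ∑ x : Fin k → G, ∑ s : Fin n → Fin k × Bool,
      ρ (FreeGroup.lift x (walkWord s)) := by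
  simp [walkOperator, sum_walkWord_eq_stepOperator_pow]

theorem commute_walkOperator [Fintype G] (ρ : Representation ℂ G V) (k n : ℕ) (g : G) :
    Commute (ρ g) (walkOperator ρ k n) := by
  rw [Commute, SemiconjBy, walkOperator_eq_sum, Finset.mul_sum, Finset.sum_mul]
  refine Fintype.sum_equiv (Equiv.piCongrRight fun _ => (MulAut.conj g).toEquiv) _ _ fun x => ?_
  have : (Equiv.piCongrRight fun _ : Fin k => (MulAut.conj g).toEquiv) x =
      fun i => g * x i * g⁻¹ := rfl
  simp only [this, freeGroupLift_conj, Finset.mul_sum, Finset.sum_mul, ← map_mul]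
  simp

end Walk

section Irreducible
variable {G V : Type*} [Group G] [AddCommGroup V] [Module ℂ V]

theorem Subrepresentation.isIrreducible_of_isAtom {ρ : Representation ℂ G V}
    {τ : Subrepresentation ρ} (hτ : IsAtom τ) : τ.toRepresentation.IsIrreducible := by
  have hne : τ.toSubmodule ≠ ⊥ := fun h => hτ.1 (Subrepresentation.toSubmodule_injective h)
  have hnt : Nontrivial τ.toSubmodule := Submodule.nontrivial_iff_ne_bot.2 hne
  have : Nontrivial (Subrepresentation τ.toRepresentation) := by
    refine ⟨⊥, ⊤, fun h => ?_⟩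
    exact bot_ne_top (congrArg Subrepresentation.toSubmodule h)
  refine ⟨fun σ => ?_⟩
  let σ' : Subrepresentation ρ := ⟨σ.toSubmodule.map τ.toSubmodule.subtype, by
    rintro g _ ⟨v, hv, rfl⟩
    exact ⟨_, σ.apply_mem_toSubmodule g hv, rfl⟩⟩
  have hle : σ' ≤ τ := by
    rintro _ ⟨v, hv, rfl⟩
    exact v.2
  have hinj := Submodule.map_injective_of_injective τ.toSubmodule.injective_subtype
  rcases hτ.le_iff.1 hle with h | h
  · left
    apply Subrepresentation.toSubmodule_injective
    apply hinj
    have := congrArg Subrepresentation.toSubmodule h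
    exact this.trans (Submodule.map_bot _).symm
  · right
    apply Subrepresentation.toSubmodule_injective
    apply hinj
    have := congrArg Subrepresentation.toSubmodule h
    exact this.trans (Submodule.map_subtype_top _).symm

theorem Subrepresentation.exists_isIrreducible_le [FiniteDimensional ℂ V]
    {ρ : Representation ℂ G V} (σ : Subrepresentation ρ) (hσ : σ ≠ ⊥) :
    ∃ τ ≤ σ, τ.toRepresentation.IsIrreducible := by
  have : WellFoundedLT (Subrepresentation ρ) :=
    StrictMono.wellFoundedLT (f := Subrepresentation.toSubmodule) fun _ _ h => h
  have := isAtomic_of_orderBot_wellFounded_lt (α := Subrepresentation ρ) wellFounded_lt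
  obtain ⟨τ, hτ, hle⟩ := (IsAtomic.eq_bot_or_exists_atom_le σ).resolve_left hσ
  exact ⟨τ, hle, isIrreducible_of_isAtom hτ⟩

theorem FDRep.simple_of_isIrreducible {G V : Type} [Group G] [Fintype G] [AddCommGroup V]
    [Module ℂ V] [FiniteDimensional ℂ V] (ρ : Representation ℂ G V) [ρ.IsIrreducible] :
    Simple (FDRep.of ρ) := by
  have := invertibleOfNonzero (NeZero.ne (Nat.card G : ℂ))
  rw [FDRep.simple_iff_char_is_norm_one]
  have h := Representation.card_inv_mul_sum_char_mul_char_eq_finrank ρ ρ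
  rw [Representation.IsIrreducible.finrank_intertwiningMap_self, Nat.cast_one,
    inv_mul_eq_one₀ (NeZero.ne _)] at h
  exact h.symm

theorem Representation.apply_eq_one_of_mem_commutator (ρ : Representation ℂ G V)
    (hV : Module.finrank ℂ V = 1) {g : G} (hg : g ∈ commutator G) : ρ g = 1 := by
  have hcomm (S T : Module.End ℂ V) : S * T = T * S := by
    obtain ⟨a, rfl, -⟩ := LinearMap.existsUnique_eq_smul_id_of_finrank_eq_one hV S
    ext v; simp
  have hle : commutator G ≤ MonoidHom.ker ρ := by
    rw [commutator_def, Subgroup.commutator_le]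
    intro a _ b _
    rw [MonoidHom.mem_ker, commutatorElement_def, map_mul, map_mul, map_mul, hcomm (ρ a),
      mul_assoc, mul_assoc, ← mul_assoc (ρ a), ← map_mul ρ a]
    simp [← map_mul]
  exact hle hg

end Irreducible

section Spectral
variable {E : Type*} [NormedAddCommGroup E] [InnerProductSpace ℂ E] [FiniteDimensional ℂ E]

theorem LinearMap.IsSymmetric.re_inner_le_of_eigenvalue_le {T : Module.End ℂ E}
    (hT : T.IsSymmetric) {c : ℝ}
    (hc : ∀ μ : ℝ, Module.End.HasEigenvalue T (μ : ℂ) → μ ≤ c) (v : E) :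
    (inner ℂ v (T v)).re ≤ c * ‖v‖ ^ 2 := by
  rw [← (hT.eigenvectorBasis rfl).sum_inner_mul_inner,
    ← (hT.eigenvectorBasis rfl).sum_sq_norm_inner_right,
    Complex.re_sum, Finset.mul_sum]
  refine Finset.sum_le_sum fun i _ => ?_
  have h1 : inner ℂ (hT.eigenvectorBasis rfl i) (T v) =
      (hT.eigenvalues rfl i : ℂ) * inner ℂ (hT.eigenvectorBasis rfl i) v := by
    rw [← hT, hT.apply_eigenvectorBasis, inner_smul_left]
    simp
  have h2 : hT.eigenvalues rfl i ≤ c := hc _ (hT.hasEigenvalue_eigenvalues rfl i)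
  rw [h1, ← inner_conj_symm v, mul_left_comm, ← Complex.normSq_eq_conj_mul_self,
    Complex.normSq_eq_norm_sq, ← Complex.ofReal_mul, Complex.ofReal_re]
  gcongr

end Spectral

section RepBound

variable {G : Type} [Group G] {E : Type} [NormedAddCommGroup E] [InnerProductSpace ℂ E]

/-- The sum over the commutator subgroup of the operators of a representation. -/
noncomputable def commutatorSum [Fintype G] {V : Type*} [AddCommGroup V] [Module ℂ V]
    (ρ : Representation ℂ G V) : Module.End ℂ V :=
  open scoped Classical in ∑ h : commutator G, ρ h

theorem commute_commutatorSum [Fintype G] {V : Type*} [AddCommGroup V] [Module ℂ V]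
    (ρ : Representation ℂ G V) (g : G) :
    Commute (ρ g) (commutatorSum ρ) := by
  classical
  rw [Commute, SemiconjBy, commutatorSum, Finset.mul_sum, Finset.sum_mul]
  refine Fintype.sum_equiv (MulAut.conjNormal g).toEquiv _ _ fun h => ?_
  simp only [← map_mul]
  simp

theorem isSymmetric_stepOperator {ρ : Representation ℂ G E}
    (hρ : ∀ g v w, inner ℂ (ρ g v) w = inner ℂ v (ρ g⁻¹ w)) {k : ℕ} (x : Fin k → G) :
    (stepOperator ρ x).IsSymmetric := by
  intro v w
  simp only [stepOperator, LinearMap.sum_apply, sum_inner, inner_sum, hρ]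
  refine Fintype.sum_equiv ((Equiv.refl _).prodCongr Equiv.boolNot) _ _ fun ⟨i, b⟩ => ?_
  cases b <;> simp [stepWord]

theorem eigenvalue_walkOperator_le [Fintype G] [FiniteDimensional ℂ E] {k n : ℕ} {b : ℝ}
    (hexp : ∀ V : FDRep ℂ G, Simple V → V.character 1 ≠ 1 →
      (∑ s : Fin n → Fin k × Bool, ∑ x : Fin k → G,
        (V.character (FreeGroup.lift x (walkWord s))).re / (V.character 1).re) ≤ b)
    (ρ : Representation ℂ G E) {v : E} (hv : v ≠ 0) (hv0 : commutatorSum ρ v = 0)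
    {μ : ℝ} (hμ : walkOperator ρ k n v = (μ : ℂ) • v) : μ ≤ b := by
  classical
  let σ : Subrepresentation ρ :=
    ⟨LinearMap.ker (commutatorSum ρ) ⊓ Module.End.eigenspace (walkOperator ρ k n) (μ : ℂ), by
      rintro g w ⟨hw1, hw2⟩
      rw [SetLike.mem_coe, LinearMap.mem_ker] at hw1
      rw [SetLike.mem_coe, Module.End.mem_eigenspace_iff] at hw2
      refine ⟨?_, ?_⟩
      · have := LinearMap.congr_fun (commute_commutatorSum ρ g) w
        simp only [Module.End.mul_apply] at this
        simp [← this, hw1]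
      · have := LinearMap.congr_fun (commute_walkOperator ρ k n g) w
        simp only [Module.End.mul_apply] at this
        simp [← this, hw2]⟩
  have hvσ : v ∈ σ.toSubmodule := ⟨hv0, Module.End.mem_eigenspace_iff.2 hμ⟩
  have hσ : σ ≠ ⊥ := by
    intro h
    rw [h] at hvσ
    exact hv ((Submodule.mem_bot ℂ).1 hvσ)
  obtain ⟨τ, hτσ, hτ⟩ := σ.exists_isIrreducible_le hσ
  have hsimple := FDRep.simple_of_isIrreducible τ.toRepresentation
  have hnt : Nontrivial τ.toSubmodule := by
    by_contra h
    rw [not_nontrivial_iff_subsingleton] at h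
    have := hτ.toNontrivial
    obtain ⟨a, b, hab⟩ := exists_pair_ne (Subrepresentation τ.toRepresentation)
    exact hab (Subrepresentation.toSubmodule_injective (Subsingleton.elim _ _))
  have hT : walkOperator τ.toRepresentation k n = (μ : ℂ) • LinearMap.id := by
    ext w
    have := Module.End.mem_eigenspace_iff.1 (hτσ w.2).2
    simp only [walkOperator_eq_sum, LinearMap.sum_apply] at this ⊢
    have hcoe (g : G) : (τ.toRepresentation g w : E) = ρ g w := rfl
    simpa [hcoe] using this
  have hpos : 0 < Module.finrank ℂ τ.toSubmodule := Module.finrank_pos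
  have hone : (FDRep.of τ.toRepresentation).character 1 = Module.finrank ℂ τ.toSubmodule :=
    FDRep.char_one _
  have hne : (FDRep.of τ.toRepresentation).character 1 ≠ 1 := by
    intro h
    rw [hone] at h
    have h1 : Module.finrank ℂ τ.toSubmodule = 1 := by exact_mod_cast h
    obtain ⟨w, hw⟩ := exists_ne (0 : τ.toSubmodule)
    have h0 : commutatorSum ρ w = 0 := (hτσ w.2).1
    have h2 : ∀ h : commutator G, ρ h w = w := fun h => by
      have := τ.toRepresentation.apply_eq_one_of_mem_commutator h1 h.2
      exact congrArg Subtype.val (LinearMap.congr_fun this w)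
    simp only [commutatorSum, LinearMap.sum_apply, h2, Finset.sum_const, Finset.card_univ] at h0
    rw [← Nat.cast_smul_eq_nsmul ℂ, smul_eq_zero] at h0
    rcases h0 with h0 | h0
    · exact Fintype.card_ne_zero (Nat.cast_eq_zero.1 h0)
    · exact hw (Subtype.ext h0)
  have hle := hexp _ hsimple hne
  have htr : ∑ s : Fin n → Fin k × Bool, ∑ x : Fin k → G,
      (FDRep.of τ.toRepresentation).character (FreeGroup.lift x (walkWord s)) =
        (μ : ℂ) * Module.finrank ℂ τ.toSubmodule := by
    have := congrArg (LinearMap.trace ℂ τ.toSubmodule) hT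
    rw [walkOperator_eq_sum, map_smul, LinearMap.trace_id, smul_eq_mul] at this
    rw [← this, Finset.sum_comm]
    simp only [map_sum]
    rfl
  have hre := congrArg Complex.re htr
  simp only [Complex.re_sum] at hre
  simp only [← Finset.sum_div] at hle
  rw [hre, hone] at hle
  have hne0 : (Module.finrank ℂ τ.toSubmodule : ℝ) ≠ 0 := by exact_mod_cast hpos.ne'
  simpa [hne0] using hle

theorem sum_norm_sq_stepOperator_pow_le [Fintype G] [FiniteDimensional ℂ E] {k ℓ : ℕ} {b : ℝ}
    (hexp : ∀ V : FDRep ℂ G, Simple V → V.character 1 ≠ 1 →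
      (∑ s : Fin (2 * ℓ) → Fin k × Bool, ∑ x : Fin k → G,
        (V.character (FreeGroup.lift x (walkWord s))).re / (V.character 1).re) ≤ b)
    {ρ : Representation ℂ G E} (hρ : ∀ g v w, inner ℂ (ρ g v) w = inner ℂ v (ρ g⁻¹ w))
    {v : E} (hv : commutatorSum ρ v = 0) :
    ∑ x : Fin k → G, ‖(stepOperator ρ x ^ ℓ) v‖ ^ 2 ≤ b * ‖v‖ ^ 2 := by
  have hTs : (walkOperator ρ k (2 * ℓ)).IsSymmetric := by
    intro v w
    simp only [walkOperator, LinearMap.sum_apply, sum_inner, inner_sum]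
    exact Finset.sum_congr rfl fun x _ => (isSymmetric_stepOperator hρ x).pow _ v w
  have hcomm : Commute (commutatorSum ρ) (walkOperator ρ k (2 * ℓ)) := by
    unfold commutatorSum
    exact Commute.sum_left _ _ _ fun h _ => commute_walkOperator ρ k _ _
  have hinv : ∀ w ∈ LinearMap.ker (commutatorSum ρ),
      walkOperator ρ k (2 * ℓ) w ∈ LinearMap.ker (commutatorSum ρ) := by
    intro w hw
    have := LinearMap.congr_fun hcomm w
    simp only [Module.End.mul_apply] at this
    rw [LinearMap.mem_ker] at hw ⊢
    rw [this, hw, map_zero]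
  have key := (hTs.restrict_invariant hinv).re_inner_le_of_eigenvalue_le (c := b) (by
    intro μ hμ
    obtain ⟨w, hw⟩ := hμ.exists_hasEigenvector
    refine eigenvalue_walkOperator_le hexp ρ (v := w) (by simpa using hw.2) w.2 ?_
    exact congrArg Subtype.val hw.apply_eq_smul) ⟨v, hv⟩
  refine le_trans (le_of_eq ?_) key
  change _ = (inner ℂ v (walkOperator ρ k (2 * ℓ) v)).re
  simp only [walkOperator, LinearMap.sum_apply, inner_sum, Complex.re_sum]
  refine Finset.sum_congr rfl fun x _ => ?_
  rw [two_mul, pow_add, Module.End.mul_apply, ← (isSymmetric_stepOperator hρ x).pow,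
    inner_self_eq_norm_sq_to_K]
  norm_cast

end RepBound

section FibreDensity

variable {G : Type} [Group G]

/-- The density of `𝒞` in the coset of the commutator subgroup through `a`. -/
noncomputable def fibreDensity (𝒞 : Set G) (a : G) : ℝ :=
  (Nat.card {g : G // g ∈ 𝒞 ∧ a⁻¹ * g ∈ commutator G} : ℝ) / (Nat.card (commutator G) : ℝ)

theorem minFibreDensity_le_fibreDensity [Finite G] (𝒞 : Set G) (a : G) :
    minFibreDensity 𝒞 ≤ fibreDensity 𝒞 a :=
  ciInf_le (Set.finite_range (fibreDensity 𝒞)).bddBelow a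

theorem fibreDensity_mul_right (𝒞 : Set G) (a : G) {h : G} (hh : h ∈ commutator G) :
    fibreDensity 𝒞 (a * h) = fibreDensity 𝒞 a := by
  simp only [fibreDensity, mul_inv_rev, mul_assoc,
    Subgroup.mul_mem_cancel_left _ ((commutator G).inv_mem hh)]

theorem card_commutator_mul_fibreDensity [Finite G] (𝒞 : Set G) (a : G) :
    Nat.card (commutator G) * fibreDensity 𝒞 a =
      Nat.card {h : commutator G // a * (h : G) ∈ 𝒞} := by
  have h0 : (Nat.card (commutator G) : ℝ) ≠ 0 := by exact_mod_cast Nat.card_pos.ne'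
  rw [fibreDensity, mul_div_cancel₀ _ h0]
  refine congrArg Nat.cast (Nat.card_congr ?_)
  exact
    { toFun := fun g => ⟨⟨a⁻¹ * g, g.2.2⟩, by simpa using g.2.1⟩
      invFun := fun h => ⟨a * h.1, h.2, by simp⟩
      left_inv := fun g => by simp
      right_inv := fun h => by simp }

open scoped Classical in
/-- The indicator function of `𝒞`, rescaled to have average one on every coset of the
commutator subgroup. -/
noncomputable def balancedIndicator (𝒞 : Set G) (g : G) : ℝ :=
  if g ∈ 𝒞 then (fibreDensity 𝒞 g)⁻¹ else 0

open scoped Classical in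
theorem sum_commutator_balancedIndicator [Fintype G] {𝒞 : Set G} (hδ : 0 < minFibreDensity 𝒞)
    (a : G) :
    ∑ h : commutator G, balancedIndicator 𝒞 (a * h) = Nat.card (commutator G) := by
  have h0 : fibreDensity 𝒞 a ≠ 0 := (hδ.trans_le (minFibreDensity_le_fibreDensity 𝒞 a)).ne'
  have h1 (h : commutator G) : balancedIndicator 𝒞 (a * h) =
      if a * (h : G) ∈ 𝒞 then (fibreDensity 𝒞 a)⁻¹ else 0 := by
    simp only [balancedIndicator, fibreDensity_mul_right 𝒞 a h.2]
  have h2 := card_commutator_mul_fibreDensity 𝒞 a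
  rw [Nat.card_eq_fintype_card (α := {h : commutator G // _}), Fintype.card_subtype] at h2
  simp only [h1, ← Finset.sum_filter, Finset.sum_const, nsmul_eq_mul, ← h2]
  field_simp

theorem sum_balancedIndicator [Fintype G] {𝒞 : Set G} (hδ : 0 < minFibreDensity 𝒞) :
    ∑ g : G, balancedIndicator 𝒞 g = Fintype.card G := by
  classical
  have h0 : (Nat.card (commutator G) : ℝ) ≠ 0 := by exact_mod_cast Nat.card_pos.ne'
  have h1 : ∑ h : commutator G, ∑ g : G, balancedIndicator 𝒞 (g * h) =
      Nat.card (commutator G) * Fintype.card G := by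
    rw [Finset.sum_comm]
    simp [sum_commutator_balancedIndicator hδ, mul_comm]
  have h2 (h : commutator G) : ∑ g : G, balancedIndicator 𝒞 (g * h) =
      ∑ g : G, balancedIndicator 𝒞 g :=
    Fintype.sum_equiv (Equiv.mulRight (h : G)) _ _ fun _ => rfl
  simp only [h2, Finset.sum_const, Finset.card_univ, nsmul_eq_mul,
    ← Nat.card_eq_fintype_card (α := commutator G)] at h1
  exact mul_left_cancel₀ h0 h1

theorem sum_balancedIndicator_sub_one_sq_le [Fintype G] {𝒞 : Set G}
    (hδ : 0 < minFibreDensity 𝒞) :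
    ∑ g : G, (balancedIndicator 𝒞 g - 1) ^ 2 ≤ (minFibreDensity 𝒞)⁻¹ * Fintype.card G := by
  have hsum := sum_balancedIndicator hδ
  have hpt (g : G) : (balancedIndicator 𝒞 g - 1) ^ 2 ≤
      (minFibreDensity 𝒞)⁻¹ * balancedIndicator 𝒞 g - 2 * balancedIndicator 𝒞 g + 1 := by
    have hle := inv_anti₀ hδ (minFibreDensity_le_fibreDensity 𝒞 g)
    have hpos : 0 ≤ (fibreDensity 𝒞 g)⁻¹ :=
      inv_nonneg.2 (hδ.le.trans (minFibreDensity_le_fibreDensity 𝒞 g))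
    unfold balancedIndicator
    split
    · nlinarith
    · norm_num
  refine (Finset.sum_le_sum fun g _ => hpt g).trans ?_
  rw [Finset.sum_add_distrib, Finset.sum_sub_distrib, ← Finset.mul_sum, ← Finset.mul_sum, hsum]
  simp only [Finset.sum_const, Finset.card_univ, nsmul_eq_mul, mul_one]
  have : (0 : ℝ) ≤ Fintype.card G := Nat.cast_nonneg _
  linarith

end FibreDensity

section RightRegular

variable {G : Type} [Group G]

/-- The action of a group on functions by right translation of the argument. -/
noncomputable def rightRegular (G : Type) [Group G] :
    Representation ℂ G (EuclideanSpace ℂ G) where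
  toFun g :=
    { toFun := fun φ => WithLp.toLp 2 fun y => φ (y * g)
      map_add' := fun _ _ => rfl
      map_smul' := fun _ _ => rfl }
  map_one' := by ext φ y; simp
  map_mul' g h := LinearMap.ext fun φ => PiLp.ext fun y => congrArg φ (mul_assoc y g h).symm

theorem rightRegular_apply (g : G) (φ : EuclideanSpace ℂ G) (y : G) :
    rightRegular G g φ y = φ (y * g) := rfl

theorem inner_rightRegular [Fintype G] (g : G) (φ ψ : EuclideanSpace ℂ G) :
    inner ℂ (rightRegular G g φ) ψ = inner ℂ φ (rightRegular G g⁻¹ ψ) := by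
  simp only [PiLp.inner_apply, rightRegular_apply]
  exact Fintype.sum_equiv (Equiv.mulRight g) _ _ fun y => by simp

end RightRegular

/-- **The `x·w(y, z)` trick for normal subsets** (Corollary 5.2). Let `G` be a
finite group and `𝒞 ⊆ G` a conjugation-closed subset with minimal fibre density
`δ > 0` over the abelianization. Let `B ≥ 0`, and suppose that for every
nonlinear irreducible character `χ` of `G` the expectation (jointly over a random
walk `w` of length `2ℓ` in `F_k` and independent uniform `x_1, …, x_k ∈ G`) of
`Re χ(w(x_1, …, x_k))/χ(1)` is at most `B`. Then for independent uniform
`x_0, x_1, …, x_k ∈ G`, the probability that `x_0·u(x_1, …, x_k) ∉ 𝒞` for every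
word `u ∈ F_k` of reduced length at most `ℓ` is at most `δ⁻¹·B`. -/
theorem stmt12 (G : Type) [Group G] [Fintype G] (k ℓ : ℕ) (hk : 1 ≤ k) (hℓ : 1 ≤ ℓ)
    (𝒞 : Set G) (hconj : ∀ g ∈ 𝒞, ∀ h : G, h * g * h⁻¹ ∈ 𝒞)
    (hδ : 0 < minFibreDensity 𝒞)
    (B : ℝ) (hB : 0 ≤ B)
    (hexp : ∀ V : FDRep ℂ G, Simple V → V.character 1 ≠ 1 →
      (∑' s : Fin (2 * ℓ) → Fin k × Bool, ∑' x : Fin k → G,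
          (V.character (FreeGroup.lift x (walkWord s))).re / (V.character 1).re) /
          (((2 * k : ℕ) : ℝ) ^ (2 * ℓ) * (Fintype.card G : ℝ) ^ k) ≤ B) :
    (Nat.card {t : G × (Fin k → G) //
        ∀ u : FreeGroup (Fin k), u.norm ≤ ℓ →
          t.1 * FreeGroup.lift t.2 u ∉ 𝒞} : ℝ) /
        (Fintype.card G : ℝ) ^ (k + 1) ≤
      (minFibreDensity 𝒞)⁻¹ * B := by
  classical
  let φ : EuclideanSpace ℂ G := WithLp.toLp 2 fun g => ((balancedIndicator 𝒞 g - 1 : ℝ) : ℂ)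
  have hφ (g : G) : φ g = ((balancedIndicator 𝒞 g - 1 : ℝ) : ℂ) := rfl
  have hN : (0 : ℝ) < ((2 * k : ℕ) : ℝ) := by exact_mod_cast (by omega : 0 < 2 * k)
  have hG : (0 : ℝ) < (Fintype.card G : ℝ) := by exact_mod_cast Fintype.card_pos
  have hφ0 : commutatorSum (rightRegular G) φ = 0 := by
    ext a
    have h1 : ∑ h : commutator G, (balancedIndicator 𝒞 (a * h) - 1) = 0 := by
      rw [Finset.sum_sub_distrib, sum_commutator_balancedIndicator hδ]
      simp
    simp only [commutatorSum, LinearMap.sum_apply, WithLp.ofLp_sum, Finset.sum_apply,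
      rightRegular_apply, hφ, ← Complex.ofReal_sum, h1]
    simp
  have hnorm : ‖φ‖ ^ 2 ≤ (minFibreDensity 𝒞)⁻¹ * Fintype.card G := by
    rw [EuclideanSpace.norm_sq_eq]
    simp only [hφ, Complex.norm_real, Real.norm_eq_abs, sq_abs]
    exact sum_balancedIndicator_sub_one_sq_le hδ
  have hbound := sum_norm_sq_stepOperator_pow_le (k := k) (ℓ := ℓ)
    (b := B * (((2 * k : ℕ) : ℝ) ^ (2 * ℓ) * (Fintype.card G : ℝ) ^ k)) (fun V hV hV1 => by
      have := hexp V hV hV1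
      rw [div_le_iff₀ (by positivity)] at this
      simpa only [tsum_fintype] using this) inner_rightRegular hφ0
  have hval (x : Fin k → G) (y : G)
      (hy : ∀ u : FreeGroup (Fin k), u.norm ≤ ℓ → y * FreeGroup.lift x u ∉ 𝒞) :
      ‖(stepOperator (rightRegular G) x ^ ℓ) φ y‖ ^ 2 = ((2 * k : ℕ) : ℝ) ^ (2 * ℓ) := by
    have hs (s : Fin ℓ → Fin k × Bool) : φ (y * FreeGroup.lift x (walkWord s)) = -1 := by
      rw [hφ, balancedIndicator, if_neg (hy _ (norm_walkWord_le s))]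
      simp
    rw [← sum_walkWord_eq_stepOperator_pow]
    simp only [LinearMap.sum_apply, WithLp.ofLp_sum, Finset.sum_apply, rightRegular_apply, hs]
    simp [mul_pow, pow_mul, mul_comm]
  have hcount : ((2 * k : ℕ) : ℝ) ^ (2 * ℓ) * (Nat.card {t : G × (Fin k → G) //
      ∀ u : FreeGroup (Fin k), u.norm ≤ ℓ → t.1 * FreeGroup.lift t.2 u ∉ 𝒞} : ℝ) ≤
      ∑ x : Fin k → G, ‖(stepOperator (rightRegular G) x ^ ℓ) φ‖ ^ 2 := by
    simp only [EuclideanSpace.norm_sq_eq]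
    rw [Finset.sum_comm, ← Fintype.sum_prod_type' (f := fun y x =>
      ‖(stepOperator (rightRegular G) x ^ ℓ) φ y‖ ^ 2), Nat.card_eq_fintype_card,
      Fintype.card_subtype, mul_comm, ← nsmul_eq_mul]
    refine le_trans (Finset.card_nsmul_le_sum _ _ _ fun t ht => ?_)
      (Finset.sum_le_univ_sum_of_nonneg fun t => by positivity)
    exact (hval t.2 t.1 (Finset.mem_filter.1 ht).2).ge
  rw [div_le_iff₀ (by positivity)]
  refine le_of_mul_le_mul_left ?_ (pow_pos hN (2 * ℓ))
  calc _ ≤ _ := hcount.trans hbound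
    _ ≤ _ := mul_le_mul_of_nonneg_left hnorm (by positivity)
    _ = _ := by ring
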